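/- arXiv:math/0505619 — 4 statements merged into one kernel-verified Lean document; each statement's English description precedes it below -/
import Mathlib

section
/- Let a chain datum on [a,b] satisfy the moment map relations, the stability condition, the ε-condition, and be s-bounded. Then for every i with a ≤ i−s−2 and i+s+1 ≤ b: the map x_i restricts to a linear isomorphism from range Xcomp(s, i+s) ⊆ V_i onto range Xcomp(s, i−1+s) ⊆ V_{i−1}, and the map y_i restricts to a linear isomorphism from range Ycomp(s, i−1−s) ⊆ V_{i−1} onto range Ycomp(s, i−s) ⊆ V_i; consequently dim V_i = dim V_{i−1}, and hence dim V_j takes the same value for all j with a+s+2 ≤ j ≤ b−s−1. (In quiver-variety terms: if a stable nilpotent framed representation with ε = 0 on a type-A segment exists, then the dimension vector is constant on the s-interior of that segment, i.e., it is deep.) -/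
/-!
A *chain datum* on an integer interval `[a,b]`: finite-dimensional complex vector
spaces `V j` and linear maps `x j : V j → V (j-1)`, `y j : V (j-1) → V j`.
(The data is given for all `j : ℤ`; all hypotheses and conclusions only refer to
indices in the interval `[a,b]`.)
-/

variable (V : ℤ → Type) [∀ j, AddCommGroup (V j)] [∀ j, Module ℂ (V j)]
  [∀ j, FiniteDimensional ℂ (V j)]

/-- Transport along an equality of indices. -/
def castV {i j : ℤ} (h : i = j) : V i →ₗ[ℂ] V j := by subst h; exact LinearMap.id

variable (x : ∀ j : ℤ, V j →ₗ[ℂ] V (j - 1)) (y : ∀ j : ℤ, V (j - 1) →ₗ[ℂ] V j)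

/-- `Xcomp ℓ i = x_{i-ℓ+1} ∘ ⋯ ∘ x_i : V i → V (i - ℓ)`. -/
def Xcomp : (ℓ : ℕ) → (i : ℤ) → (V i →ₗ[ℂ] V (i - (ℓ : ℤ)))
  | 0, i => castV V (by simp)
  | (ℓ + 1), i =>
      (castV V (show i - 1 - (ℓ : ℤ) = i - ((ℓ : ℕ) + 1 : ℕ) by push_cast; ring)).comp
        ((Xcomp ℓ (i - 1)).comp (x i))

/-- `Ycomp ℓ i = y_{i+ℓ} ∘ ⋯ ∘ y_{i+1} : V i → V (i + ℓ)`. -/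
def Ycomp : (ℓ : ℕ) → (i : ℤ) → (V i →ₗ[ℂ] V (i + (ℓ : ℤ)))
  | 0, i => castV V (by simp)
  | (ℓ + 1), i =>
      (castV V (show i + 1 + (ℓ : ℤ) = i + ((ℓ : ℕ) + 1 : ℕ) by push_cast; ring)).comp
        ((Ycomp ℓ (i + 1)).comp ((y (i + 1)).comp (castV V (show i = i + 1 - 1 by ring))))

/-- The moment map relations `y_j ∘ x_j = x_{j+1} ∘ y_{j+1}` for `a < j < b`. -/
def MomentMap (a b : ℤ) : Prop :=
  ∀ j : ℤ, a < j → j < b →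
    (y j).comp (x j) =
      (castV V (show j + 1 - 1 = j by ring)).comp
        ((x (j + 1)).comp ((y (j + 1)).comp (castV V (show j = j + 1 - 1 by ring))))

/-- The stability condition: `ker x_p ∩ ker y_{p+1} = 0` for `a < p < b`. -/
def Stability (a b : ℤ) : Prop :=
  ∀ p : ℤ, a < p → p < b →
    LinearMap.ker (x p) ⊓
      LinearMap.ker ((y (p + 1)).comp (castV V (show p = p + 1 - 1 by ring))) = ⊥

/-- The ε-condition: `V_p = range x_{p+1} + range y_p` for `a < p < b`. -/
def EpsCond (a b : ℤ) : Prop :=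
  ∀ p : ℤ, a < p → p < b →
    LinearMap.range ((castV V (show p + 1 - 1 = p by ring)).comp (x (p + 1))) ⊔
      LinearMap.range (y p) = ⊤

/-- `s`-boundedness: each `y_j ∘ x_j` is nilpotent and `dim V_j ≤ s` on `[a,b]`. -/
def SBounded (s : ℕ) (a b : ℤ) : Prop :=
  (∀ j : ℤ, a < j → j ≤ b → IsNilpotent ((y j).comp (x j) : Module.End ℂ (V j))) ∧
  (∀ j : ℤ, a ≤ j → j ≤ b → Module.finrank ℂ (V j) ≤ s)

theorem Submodule.finrank_map_eq_of_forall_eq_zero {K M : Type*}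
    [Field K] [AddCommGroup M] [Module K M] (f : Module.End K M)
    (p : Submodule K M) (hf : ∀ v ∈ p, f v = 0 → v = 0) :
    Module.finrank K (p.map f) = Module.finrank K p := by
  rw [← LinearMap.range_domRestrict]
  refine LinearMap.finrank_range_of_inj ((injective_iff_map_eq_zero _).2 fun v hv => ?_)
  exact Subtype.ext (hf v v.2 hv)

/-- A pair of endomorphisms `X`, `Y` of one module `M`, of degrees `-1` and `1` with respect to a
family of submodules `P j`, which on the degrees `a < j < b` commute, are jointly injective and
jointly surjective, and satisfy `(Y * X) ^ s = 0`. -/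
structure IsChainPair {K M : Type*} [Ring K] [AddCommGroup M] [Module K M]
    (X Y : Module.End K M) (P : ℤ → Submodule K M) (s : ℕ) (a b : ℤ) : Prop where
  x_mem : ∀ {j k : ℤ} {v : M}, v ∈ P j → k = j - 1 → X v ∈ P k
  y_mem : ∀ {j k : ℤ} {v : M}, v ∈ P j → k = j + 1 → Y v ∈ P k
  comm : ∀ {j : ℤ} {v : M}, a < j → j < b → v ∈ P j → X (Y v) = Y (X v)
  stable : ∀ {j : ℤ} {v : M}, a < j → j < b → v ∈ P j → X v = 0 → Y v = 0 → v = 0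
  exists_add : ∀ {j : ℤ} {v : M}, a < j → j < b → v ∈ P j →
    ∃ u ∈ P (j + 1), ∃ w ∈ P (j - 1), v = X u + Y w
  nilp : ∀ {j : ℤ} {v : M}, a < j → j < b → v ∈ P j → ((Y * X) ^ s) v = 0

namespace IsChainPair

section Ring

variable {K M : Type*} [Ring K] [AddCommGroup M] [Module K M]
  {X Y : Module.End K M} {P : ℤ → Submodule K M} {s : ℕ} {a b : ℤ}

theorem mul_pow_apply_comm (H : IsChainPair X Y P s a b) {j : ℤ} {v : M} (ha : a < j)
    (hb : j < b) (hv : v ∈ P j) (k : ℕ) : ((X * Y) ^ k) v = ((Y * X) ^ k) v := by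
  induction k generalizing v with
  | zero => rfl
  | succ k ih =>
    rw [pow_succ, pow_succ, Module.End.mul_apply, Module.End.mul_apply, Module.End.mul_apply,
      Module.End.mul_apply, H.comm ha hb hv]
    exact ih (H.y_mem (H.x_mem hv rfl) (by ring))

/-- Exchanging the two maps reverses the degrees. -/
theorem symm (H : IsChainPair X Y P s a b) :
    IsChainPair Y X (fun j => P (-j)) s (-b) (-a) where
  x_mem hv hk := H.y_mem hv (by lia)
  y_mem hv hk := H.x_mem hv (by lia)
  comm ha hb hv := (H.comm (by lia) (by lia) hv).symm
  stable ha hb hv hx hy := H.stable (by lia) (by lia) hv hy hx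
  exists_add {j v} ha hb hv := by
    obtain ⟨u, hu, w, hw, h⟩ := H.exists_add (by lia) (by lia) hv
    refine ⟨w, ?_, u, ?_, by rw [h, add_comm]⟩
    · rwa [show -(j + 1) = -j - 1 by ring]
    · rwa [show -(j - 1) = -j + 1 by ring]
  nilp ha hb hv := by
    rw [H.mul_pow_apply_comm (by lia) (by lia) hv]
    exact H.nilp (by lia) (by lia) hv

theorem y_pow_mem (H : IsChainPair X Y P s a b) {j l : ℤ} {v : M} (hv : v ∈ P j) (k : ℕ)
    (hl : l = j + k) : (Y ^ k) v ∈ P l := by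
  induction k generalizing l with
  | zero => simpa [hl] using hv
  | succ k ih =>
    rw [pow_succ', Module.End.mul_apply]
    exact H.y_mem (ih rfl) (by push_cast at hl; lia)

theorem x_pow_mem (H : IsChainPair X Y P s a b) {j l : ℤ} {v : M} (hv : v ∈ P j) (k : ℕ)
    (hl : l = j - k) : (X ^ k) v ∈ P l := by
  simpa using H.symm.y_pow_mem (j := -j) (l := -l) (by simpa using hv) k (by lia)

theorem x_y_pow (H : IsChainPair X Y P s a b) {j : ℤ} {v : M} (hv : v ∈ P j) (k : ℕ)
    (ha : a < j) (hb : j + k ≤ b) : X ((Y ^ k) v) = (Y ^ k) (X v) := by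
  induction k with
  | zero => rfl
  | succ k ih =>
    push_cast at hb
    rw [pow_succ', Module.End.mul_apply, Module.End.mul_apply,
      H.comm (by lia) (by lia) (H.y_pow_mem hv k rfl), ih (by lia)]

theorem y_x_pow (H : IsChainPair X Y P s a b) {j : ℤ} {v : M} (hv : v ∈ P j) (k : ℕ)
    (ha : a ≤ j - k) (hb : j < b) : Y ((X ^ k) v) = (X ^ k) (Y v) :=
  H.symm.x_y_pow (j := -j) (by simpa using hv) k (by lia) (by lia)

theorem x_pow_y_pow (H : IsChainPair X Y P s a b) {j : ℤ} {v : M} (hv : v ∈ P j) (k : ℕ)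
    (ha : a < j) (hb : j + k ≤ b) : (X ^ k) ((Y ^ k) v) = ((Y * X) ^ k) v := by
  induction k generalizing v with
  | zero => rfl
  | succ k ih =>
    push_cast at hb
    have h := H.x_y_pow hv (k + 1) ha (by push_cast; lia)
    rw [pow_succ X, Module.End.mul_apply, h, pow_succ Y, Module.End.mul_apply,
      ih (H.y_mem (H.x_mem hv rfl) (by ring)) (by lia), pow_succ (Y * X), Module.End.mul_apply]
    rfl

theorem x_pow_y_pow_eq_zero (H : IsChainPair X Y P s a b) {j : ℤ} {v : M} (hv : v ∈ P j)
    (ha : a < j) (hj : j < b) (hb : j + s ≤ b) : (X ^ s) ((Y ^ s) v) = 0 := by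
  rw [H.x_pow_y_pow hv s ha hb, H.nilp ha hj hv]

theorem y_pow_x_pow_eq_zero (H : IsChainPair X Y P s a b) {j : ℤ} {v : M} (hv : v ∈ P j)
    (ha : a ≤ j - s) (hj : a < j) (hb : j < b) : (Y ^ s) ((X ^ s) v) = 0 :=
  H.symm.x_pow_y_pow_eq_zero (j := -j) (by simpa using hv) (by lia) (by lia) (by lia)

theorem eq_zero_of_x_eq_zero (H : IsChainPair X Y P s a b) {j : ℤ} {v : M} (hv : v ∈ P j)
    (k : ℕ) (ha : a < j) (hb : j + k ≤ b) (hx : X v = 0) (hy : (Y ^ k) v = 0) : v = 0 := by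
  induction k with
  | zero => exact hy
  | succ k ih =>
    push_cast at hb
    rw [pow_succ', Module.End.mul_apply] at hy
    refine ih (by lia) (H.stable (j := j + k) (by lia) (by lia) (H.y_pow_mem hv k rfl) ?_ hy)
    rw [H.x_y_pow hv k ha (by lia), hx, map_zero]

theorem eq_zero_of_y_eq_zero (H : IsChainPair X Y P s a b) {j : ℤ} {v : M} (hv : v ∈ P j)
    (k : ℕ) (ha : a ≤ j - k) (hb : j < b) (hy : Y v = 0) (hx : (X ^ k) v = 0) : v = 0 :=
  H.symm.eq_zero_of_x_eq_zero (j := -j) (by simpa using hv) k (by lia) (by lia) hy hx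

theorem eq_zero_of_mul_eq_zero (H : IsChainPair X Y P s a b) {j : ℤ} {v : M} (hv : v ∈ P j)
    (k : ℕ) (ha : a < j - k) (hb : j + k < b) (hx : (X ^ k) v = 0) (hy : (Y ^ k) v = 0)
    (h : X (Y v) = 0) : v = 0 := by
  cases k with
  | zero => exact hx
  | succ k =>
    push_cast at ha hb
    rw [pow_succ, Module.End.mul_apply] at hx hy
    refine H.stable (j := j) (by lia) (by lia) hv ?_ ?_
    · refine H.eq_zero_of_y_eq_zero (H.x_mem hv rfl) k (by lia) (by lia) ?_ hx
      rw [← H.comm (by lia) (by lia) hv, h]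
    · exact H.eq_zero_of_x_eq_zero (H.y_mem hv rfl) k (by lia) (by lia) h hy

theorem eq_zero_of_pow_eq_zero (H : IsChainPair X Y P s a b) {j : ℤ} {v : M} (hv : v ∈ P j)
    (k : ℕ) (ha : a < j - k) (hb : j + k < b) (hx : (X ^ k) v = 0) (hy : (Y ^ k) v = 0) :
    v = 0 := by
  have key (m : ℕ) : ∀ v ∈ P j, (X ^ k) v = 0 → (Y ^ k) v = 0 → ((X * Y) ^ m) v = 0 → v = 0 := by
    induction m with
    | zero => exact fun v _ _ _ h => h
    | succ m ih =>
      intro v hv hx hy h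
      refine H.eq_zero_of_mul_eq_zero hv k ha hb hx hy
        (ih _ (H.x_mem (H.y_mem hv rfl) (by ring)) ?_ ?_ ?_)
      · rw [← Module.End.mul_apply, ← pow_succ, pow_succ', Module.End.mul_apply,
          ← H.y_x_pow hv k (by lia) (by lia), hx, map_zero, map_zero]
      · rw [H.comm (by lia) (by lia) hv, ← Module.End.mul_apply, ← pow_succ, pow_succ',
          Module.End.mul_apply, ← H.x_y_pow hv k (by lia) (by lia), hy, map_zero, map_zero]
      · rw [pow_succ, Module.End.mul_apply] at h
        exact h
  refine key s v hv hx hy ?_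
  rw [H.mul_pow_apply_comm (by lia) (by lia) hv, H.nilp (by lia) (by lia) hv]

theorem exists_x_add_y_pow (H : IsChainPair X Y P s a b) {p : ℤ} {v : M} (hv : v ∈ P p)
    (k : ℕ) (ha : a ≤ p - k) (hb : p < b) :
    ∃ u ∈ P (p + 1), ∃ w ∈ P (p - k), v = X u + (Y ^ k) w := by
  induction k with
  | zero => exact ⟨0, zero_mem _, v, by simpa using hv, by simp⟩
  | succ k ih =>
    push_cast at ha
    obtain ⟨u, hu, w, hw, rfl⟩ := ih (by lia)
    obtain ⟨u', hu', w', hw', rfl⟩ := H.exists_add (by lia) (by lia) hw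
    refine ⟨u + (Y ^ k) u', add_mem hu (H.y_pow_mem hu' k (by lia)), w', ?_, ?_⟩
    · rwa [show p - ((k + 1 : ℕ) : ℤ) = p - k - 1 by push_cast; ring]
    · rw [map_add, map_add, ← H.x_y_pow hu' k (by lia) (by lia), pow_succ, Module.End.mul_apply,
        add_assoc]

theorem exists_y_add_x_pow (H : IsChainPair X Y P s a b) {p : ℤ} {v : M} (hv : v ∈ P p)
    (k : ℕ) (ha : a < p) (hb : p + k ≤ b) :
    ∃ u ∈ P (p - 1), ∃ w ∈ P (p + k), v = Y u + (X ^ k) w := by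
  obtain ⟨u, hu, w, hw, h⟩ :=
    H.symm.exists_x_add_y_pow (p := -p) (by simpa using hv) k (by lia) (by lia)
  refine ⟨u, ?_, w, ?_, h⟩
  · rwa [show p - 1 = -(-p + 1) by ring]
  · rwa [show p + k = -(-p - k) by ring]

theorem exists_pow_add_pow_add_mul (H : IsChainPair X Y P s a b) {i : ℤ} {v : M}
    (hv : v ∈ P i) (k : ℕ) (ha : a < i - k) (hb : i + k < b) :
    ∃ u ∈ P (i + k), ∃ w ∈ P (i - k), ∃ z ∈ P i, v = (X ^ k) u + (Y ^ k) w + X (Y z) := by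
  cases k with
  | zero => exact ⟨v, by simpa using hv, 0, zero_mem _, 0, zero_mem _, by simp⟩
  | succ k =>
    obtain ⟨u, hu, w, hw, rfl⟩ := H.exists_x_add_y_pow hv (k + 1) (by lia) (by lia)
    push_cast at ha hb
    obtain ⟨z, hz, u', hu', rfl⟩ := H.exists_y_add_x_pow hu k (by lia) (by lia)
    refine ⟨u', ?_, w, hw, z, by simpa using hz, ?_⟩
    · rwa [show i + ((k + 1 : ℕ) : ℤ) = i + 1 + k by push_cast; ring]
    · rw [map_add, pow_succ' X, Module.End.mul_apply]
      abel

theorem exists_pow_add_pow (H : IsChainPair X Y P s a b) {i : ℤ} {v : M} (hv : v ∈ P i)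
    (k : ℕ) (ha : a < i - k) (hb : i + k < b) :
    ∃ u ∈ P (i + k), ∃ w ∈ P (i - k), v = (X ^ k) u + (Y ^ k) w := by
  have key (m : ℕ) : ∀ v ∈ P i, ∃ u ∈ P (i + k), ∃ w ∈ P (i - k), ∃ z ∈ P i,
      v = (X ^ k) u + (Y ^ k) w + ((X * Y) ^ m) z := by
    induction m with
    | zero => exact fun v hv => ⟨0, zero_mem _, 0, zero_mem _, v, hv, by simp⟩
    | succ m ih =>
      intro v hv
      obtain ⟨u, hu, w, hw, z, hz, rfl⟩ := H.exists_pow_add_pow_add_mul hv k ha hb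
      obtain ⟨u', hu', w', hw', z', hz', rfl⟩ := ih z hz
      refine ⟨u + X (Y u'), add_mem hu (H.x_mem (H.y_mem hu' rfl) (by ring)),
        w + Y (X w'), add_mem hw (H.y_mem (H.x_mem hw' rfl) (by ring)), z', hz', ?_⟩
      have h₁ : X (Y ((X ^ k) u')) = (X ^ k) (X (Y u')) := by
        rw [H.y_x_pow hu' k (by lia) (by lia), ← Module.End.mul_apply, ← pow_succ', pow_succ,
          Module.End.mul_apply]
      have h₂ : X (Y ((Y ^ k) w')) = (Y ^ k) (Y (X w')) := by
        rw [← Module.End.mul_apply Y, ← pow_succ',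
          H.x_y_pow hw' (k + 1) (by lia) (by push_cast; lia), pow_succ, Module.End.mul_apply]
      simp only [map_add, h₁, h₂, pow_succ' (X * Y), Module.End.mul_apply]
      abel
  obtain ⟨u, hu, w, hw, z, hz, h⟩ := key s v hv
  exact ⟨u, hu, w, hw, by
    rw [h, H.mul_pow_apply_comm (by lia) (by lia) hz, H.nilp (by lia) (by lia) hz, add_zero]⟩

theorem eq_zero_of_mem_map_x_pow (H : IsChainPair X Y P s a b) {i : ℤ} {v : M}
    (ha : a < i) (hb : i + s < b) (hv : v ∈ (P (i + s)).map (X ^ s)) (hx : X v = 0) : v = 0 := by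
  obtain ⟨w, hw, rfl⟩ := hv
  exact H.eq_zero_of_x_eq_zero (H.x_pow_mem hw s (by ring)) s ha (by lia) hx
    (H.y_pow_x_pow_eq_zero hw (by lia) (by lia) hb)

theorem map_x_map_x_pow (H : IsChainPair X Y P s a b) {i : ℤ} (ha : a < i - 1)
    (hb : i - 1 + s < b) :
    ((P (i + s)).map (X ^ s)).map X = (P (i - 1 + s)).map (X ^ s) := by
  have hcomm (u : M) : X ((X ^ s) u) = (X ^ s) (X u) := by
    rw [← Module.End.mul_apply, ← pow_succ', pow_succ, Module.End.mul_apply]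
  apply le_antisymm
  · rintro _ ⟨_, ⟨u, hu, rfl⟩, rfl⟩
    exact ⟨X u, H.x_mem hu (by ring), (hcomm u).symm⟩
  · rintro _ ⟨v, hv, rfl⟩
    obtain ⟨u, hu, w, hw, rfl⟩ := H.exists_x_add_y_pow hv s (by lia) (by lia)
    rw [show i - 1 + (s : ℤ) + 1 = i + s by ring] at hu
    refine ⟨(X ^ s) u, ⟨u, hu, rfl⟩, ?_⟩
    rw [map_add, H.x_pow_y_pow_eq_zero hw (by lia) (by lia) (by lia), add_zero, hcomm]

theorem eq_zero_of_mem_map_y_pow (H : IsChainPair X Y P s a b) {i : ℤ} {v : M}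
    (ha : a < i - s) (hb : i < b) (hv : v ∈ (P (i - s)).map (Y ^ s)) (hy : Y v = 0) : v = 0 :=
  H.symm.eq_zero_of_mem_map_x_pow (i := -i) (by lia) (by lia)
    (by rwa [show -(-i + (s : ℤ)) = i - s by ring]) hy

theorem map_y_map_y_pow (H : IsChainPair X Y P s a b) {i : ℤ} (ha : a < i - s) (hb : i < b) :
    ((P (i - 1 - s)).map (Y ^ s)).map Y = (P (i - s)).map (Y ^ s) := by
  have h := H.symm.map_x_map_x_pow (i := -i + 1) (by lia) (by lia)
  rwa [show -(-i + 1 + (s : ℤ)) = i - 1 - s by ring,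
    show -(-i + 1 - 1 + (s : ℤ)) = i - s by ring] at h

theorem map_x_pow_sup_map_y_pow (H : IsChainPair X Y P s a b) {i : ℤ} (ha : a < i - s)
    (hb : i + s < b) : (P (i + s)).map (X ^ s) ⊔ (P (i - s)).map (Y ^ s) = P i := by
  apply le_antisymm
  · refine sup_le ?_ ?_
    · rintro _ ⟨u, hu, rfl⟩
      exact H.x_pow_mem hu s (by ring)
    · rintro _ ⟨u, hu, rfl⟩
      exact H.y_pow_mem hu s (by ring)
  · intro v hv
    obtain ⟨u, hu, w, hw, rfl⟩ := H.exists_pow_add_pow hv s ha hb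
    exact Submodule.add_mem_sup ⟨u, hu, rfl⟩ ⟨w, hw, rfl⟩

theorem map_x_pow_inf_map_y_pow (H : IsChainPair X Y P s a b) {i : ℤ} (ha : a < i - s)
    (hb : i + s < b) : (P (i + s)).map (X ^ s) ⊓ (P (i - s)).map (Y ^ s) = ⊥ := by
  rw [eq_bot_iff]
  rintro v ⟨⟨u, hu, rfl⟩, ⟨w, hw, h⟩⟩
  refine H.eq_zero_of_pow_eq_zero (H.x_pow_mem hu s (by ring)) s ha hb ?_ ?_
  · rw [← h]
    exact H.x_pow_y_pow_eq_zero hw ha (by lia) (by lia)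
  · exact H.y_pow_x_pow_eq_zero hu (by lia) (by lia) hb

end Ring

section Field

variable {K M : Type*} [Field K] [AddCommGroup M] [Module K M]
  {X Y : Module.End K M} {P : ℤ → Submodule K M} {s : ℕ} {a b : ℤ}
  [∀ j, FiniteDimensional K (P j)]

theorem finrank_eq_add (H : IsChainPair X Y P s a b) {i : ℤ} (ha : a < i - s)
    (hb : i + s < b) : Module.finrank K (P i) =
      Module.finrank K ((P (i + s)).map (X ^ s)) + Module.finrank K ((P (i - s)).map (Y ^ s)) := by
  have h := Submodule.finrank_sup_add_finrank_inf_eq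
    ((P (i + s)).map (X ^ s)) ((P (i - s)).map (Y ^ s))
  rwa [H.map_x_pow_sup_map_y_pow ha hb, H.map_x_pow_inf_map_y_pow ha hb, finrank_bot,
    add_zero] at h

theorem finrank_eq_finrank_sub_one (H : IsChainPair X Y P s a b) {i : ℤ} (ha : a < i - 1 - s)
    (hb : i + s < b) : Module.finrank K (P i) = Module.finrank K (P (i - 1)) := by
  rw [H.finrank_eq_add (by lia) hb, H.finrank_eq_add ha (by lia),
    ← H.map_x_map_x_pow (by lia) (by lia), ← H.map_y_map_y_pow (by lia) (by lia),
    Submodule.finrank_map_eq_of_forall_eq_zero _ _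
      fun v hv => H.eq_zero_of_mem_map_x_pow (by lia) hb hv,
    Submodule.finrank_map_eq_of_forall_eq_zero _ _
      fun v hv => H.eq_zero_of_mem_map_y_pow ha (by lia) hv]

end Field

end IsChainPair

section Total

set_option linter.unusedSectionVars false

theorem single_castV {i j : ℤ} (h : i = j) (v : V i) :
    LinearMap.single ℂ V j (castV V h v) = LinearMap.single ℂ V i v := by
  subst h
  rfl

/-- The maps `x j` assembled into one endomorphism of the product of all `V j`. -/
def totalX : Module.End ℂ (∀ j, V j) :=
  LinearMap.pi fun j => (castV V (show j + 1 - 1 = j by ring)).comp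
    ((x (j + 1)).comp (LinearMap.proj (j + 1)))

/-- The maps `y j` assembled into one endomorphism of the product of all `V j`. -/
def totalY : Module.End ℂ (∀ j, V j) :=
  LinearMap.pi fun j => (y j).comp (LinearMap.proj (j - 1))

theorem totalX_single (i : ℤ) (v : V i) :
    totalX V x (LinearMap.single ℂ V i v) = LinearMap.single ℂ V (i - 1) (x i v) := by
  have key {j : ℤ} (h : i = j) (hx : j - 1 = i - 1) :
      castV V hx (x j (castV V h v)) = x i v := by
    subst h
    rfl
  ext k
  by_cases hk : k = i - 1
  · subst hk
    have h : i = i - 1 + 1 := by ring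
    rw [← single_castV V h v]
    simp only [totalX, LinearMap.pi_apply, LinearMap.comp_apply, LinearMap.proj_apply,
      LinearMap.coe_single, Pi.single_eq_same]
    exact key h _
  · have h : k + 1 ≠ i := by lia
    simp [totalX, hk, h]

theorem totalY_single (i : ℤ) (v : V (i - 1)) :
    totalY V y (LinearMap.single ℂ V (i - 1) v) = LinearMap.single ℂ V i (y i v) := by
  ext k
  by_cases hk : k = i
  · subst hk
    simp [totalY]
  · have h : k - 1 ≠ i - 1 := by lia
    simp [totalY, hk, h]

theorem totalY_single_castV (i : ℤ) (v : V i) (h : i = i + 1 - 1) :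
    totalY V y (LinearMap.single ℂ V i v) =
      LinearMap.single ℂ V (i + 1) (y (i + 1) (castV V h v)) := by
  rw [← totalY_single, single_castV]

theorem single_Xcomp (l : ℕ) (i : ℤ) (v : V i) :
    LinearMap.single ℂ V (i - l) (Xcomp V x l i v) =
      (totalX V x ^ l) (LinearMap.single ℂ V i v) := by
  induction l generalizing i with
  | zero => exact single_castV V _ v
  | succ l ih =>
    rw [pow_succ, Module.End.mul_apply, totalX_single, ← ih]
    exact single_castV V _ _

theorem single_Ycomp (l : ℕ) (i : ℤ) (v : V i) :
    LinearMap.single ℂ V (i + l) (Ycomp V y l i v) =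
      (totalY V y ^ l) (LinearMap.single ℂ V i v) := by
  induction l generalizing i with
  | zero => exact single_castV V _ v
  | succ l ih =>
    rw [pow_succ, Module.End.mul_apply, totalY_single_castV V y i v (by ring), ← ih]
    exact single_castV V _ _

theorem map_single_range_Xcomp (l : ℕ) (i j : ℤ) (h : j - l = i) :
    (LinearMap.range ((castV V h).comp (Xcomp V x l j))).map (LinearMap.single ℂ V i) =
      (LinearMap.range (LinearMap.single ℂ V j)).map (totalX V x ^ l) := by
  rw [← LinearMap.range_comp, ← LinearMap.range_comp]
  congr 1
  refine LinearMap.ext fun v => ?_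
  simp only [LinearMap.comp_apply, single_castV, single_Xcomp]

theorem map_single_range_Ycomp (l : ℕ) (i j : ℤ) (h : j + l = i) :
    (LinearMap.range ((castV V h).comp (Ycomp V y l j))).map (LinearMap.single ℂ V i) =
      (LinearMap.range (LinearMap.single ℂ V j)).map (totalY V y ^ l) := by
  rw [← LinearMap.range_comp, ← LinearMap.range_comp]
  congr 1
  refine LinearMap.ext fun v => ?_
  simp only [LinearMap.comp_apply, single_castV, single_Ycomp]

theorem single_injective (i : ℤ) : Function.Injective (LinearMap.single ℂ V i) :=
  Pi.single_injective i

theorem finrank_range_single (i : ℤ) :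
    Module.finrank ℂ (LinearMap.range (LinearMap.single ℂ V i)) = Module.finrank ℂ (V i) :=
  LinearMap.finrank_range_of_inj (single_injective V i)

theorem map_map_single_x (i : ℤ) (p : Submodule ℂ (V i)) :
    (p.map (x i)).map (LinearMap.single ℂ V (i - 1)) =
      (p.map (LinearMap.single ℂ V i)).map (totalX V x) := by
  rw [← Submodule.map_comp, ← Submodule.map_comp]
  congr 1
  exact LinearMap.ext fun v => (totalX_single V x i v).symm

theorem map_map_single_y (i : ℤ) (p : Submodule ℂ (V (i - 1))) :
    (p.map (y i)).map (LinearMap.single ℂ V i) =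
      (p.map (LinearMap.single ℂ V (i - 1))).map (totalY V y) := by
  rw [← Submodule.map_comp, ← Submodule.map_comp]
  congr 1
  exact LinearMap.ext fun v => (totalY_single V y i v).symm

theorem totalY_mul_totalX_pow_single (m : ℕ) (i : ℤ) (v : V i) :
    ((totalY V y * totalX V x) ^ m) (LinearMap.single ℂ V i v) =
      LinearMap.single ℂ V i ((((y i).comp (x i) : Module.End ℂ (V i)) ^ m) v) := by
  induction m generalizing v with
  | zero => rfl
  | succ m ih =>
    rw [pow_succ, pow_succ, Module.End.mul_apply, Module.End.mul_apply, Module.End.mul_apply,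
      totalX_single, totalY_single, ih, LinearMap.comp_apply]

theorem totalX_totalY_single_comm {a b : ℤ} (hmm : MomentMap V x y a b) {j : ℤ} (ha : a < j)
    (hb : j < b) (v : V j) :
    totalX V x (totalY V y (LinearMap.single ℂ V j v)) =
      totalY V y (totalX V x (LinearMap.single ℂ V j v)) := by
  have h := LinearMap.congr_fun (hmm j ha hb) v
  simp only [LinearMap.comp_apply] at h
  rw [totalX_single, totalY_single, h, single_castV, ← totalX_single,
    ← totalY_single_castV]

end Total

theorem isChainPair_total {a b : ℤ} {s : ℕ} (hmm : MomentMap V x y a b)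
    (hst : Stability V x y a b) (heps : EpsCond V x y a b) (hsb : SBounded V x y s a b) :
    IsChainPair (totalX V x) (totalY V y) (fun j => LinearMap.range (LinearMap.single ℂ V j))
      s a b where
  x_mem {j k v} hv hk := by
    obtain ⟨u, rfl⟩ := hv
    subst hk
    exact ⟨_, (totalX_single V x j u).symm⟩
  y_mem {j k v} hv hk := by
    obtain ⟨u, rfl⟩ := hv
    subst hk
    exact ⟨_, (totalY_single_castV V y j u (by ring)).symm⟩
  comm {j v} ha hb hv := by
    obtain ⟨u, rfl⟩ := hv
    exact totalX_totalY_single_comm V x y hmm ha hb u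
  stable {j v} ha hb hv hx hy := by
    obtain ⟨u, rfl⟩ := hv
    rw [totalX_single] at hx
    rw [totalY_single_castV V y j u (by ring)] at hy
    have h : u ∈ LinearMap.ker (x j) ⊓
        LinearMap.ker ((y (j + 1)).comp (castV V (show j = j + 1 - 1 by ring))) :=
      ⟨(map_eq_zero_iff _ (single_injective V _)).1 hx,
        (map_eq_zero_iff _ (single_injective V _)).1 hy⟩
    rw [hst j ha hb, Submodule.mem_bot] at h
    rw [h, map_zero]
  exists_add {j v} ha hb hv := by
    obtain ⟨u, rfl⟩ := hv
    have h : u ∈ (⊤ : Submodule ℂ (V j)) := Submodule.mem_top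
    rw [← heps j ha hb] at h
    obtain ⟨_, ⟨p, rfl⟩, _, ⟨q, rfl⟩, rfl⟩ := Submodule.mem_sup.1 h
    refine ⟨_, ⟨p, rfl⟩, _, ⟨q, rfl⟩, ?_⟩
    rw [totalX_single, totalY_single, map_add, LinearMap.comp_apply, single_castV]
  nilp {j v} ha hb hv := by
    obtain ⟨u, rfl⟩ := hv
    have hpow := LinearMap.aeval_self_charpoly ((y j).comp (x j))
    rw [IsNilpotent.charpoly_eq_X_pow_finrank (hsb.1 j ha hb.le), map_pow,
      Polynomial.aeval_X] at hpow
    replace hpow := pow_eq_zero_of_le (hsb.2 j ha.le hb.le) hpow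
    rw [totalY_mul_totalX_pow_single, hpow, LinearMap.zero_apply, map_zero]

/-- Under the moment map relations, stability, the ε-condition
and `s`-boundedness: for every `i` with `a ≤ i−s−2` and `i+s+1 ≤ b`, the map
`x i` restricts to a linear isomorphism of `range Xcomp(s, i+s) ⊆ V i` onto
`range Xcomp(s, i−1+s) ⊆ V (i−1)`, and `y i` restricts to a linear isomorphism
of `range Ycomp(s, i−1−s) ⊆ V (i−1)` onto `range Ycomp(s, i−s) ⊆ V i`;
consequently `dim V i = dim V (i−1)`, and `dim V j` is constant for
`a+s+2 ≤ j ≤ b−s−1`. -/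
theorem statement1 (a b : ℤ) (hab : a < b) (hmm : MomentMap V x y a b)
    (hst : Stability V x y a b) (heps : EpsCond V x y a b)
    (s : ℕ) (hs : 1 ≤ s) (hsb : SBounded V x y s a b) :
    (∀ i : ℤ, a ≤ i - s - 2 → i + s + 1 ≤ b →
      -- `x i` is injective on `range Xcomp(s, i+s)` …
      (∀ v ∈ LinearMap.range ((castV V (show i + (s : ℤ) - (s : ℤ) = i by ring)).comp
          (Xcomp V x s (i + s))), x i v = 0 → v = 0) ∧
      -- … and maps it onto `range Xcomp(s, i−1+s)`
      Submodule.map (x i)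
          (LinearMap.range ((castV V (show i + (s : ℤ) - (s : ℤ) = i by ring)).comp
            (Xcomp V x s (i + s))))
        = LinearMap.range ((castV V (show i - 1 + (s : ℤ) - (s : ℤ) = i - 1 by ring)).comp
            (Xcomp V x s (i - 1 + s))) ∧
      -- `y i` is injective on `range Ycomp(s, i−1−s)` …
      (∀ v ∈ LinearMap.range ((castV V (show i - 1 - (s : ℤ) + (s : ℤ) = i - 1 by ring)).comp
          (Ycomp V y s (i - 1 - s))), y i v = 0 → v = 0) ∧
      -- … and maps it onto `range Ycomp(s, i−s)`
      Submodule.map (y i)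
          (LinearMap.range ((castV V (show i - 1 - (s : ℤ) + (s : ℤ) = i - 1 by ring)).comp
            (Ycomp V y s (i - 1 - s))))
        = LinearMap.range ((castV V (show i - (s : ℤ) + (s : ℤ) = i by ring)).comp
            (Ycomp V y s (i - s))) ∧
      -- consequently the dimensions agree
      Module.finrank ℂ (V i) = Module.finrank ℂ (V (i - 1))) ∧
    -- hence `dim V j` is constant on the `s`-interior `[a+s+2, b−s−1]`
    (∀ j j' : ℤ, a + s + 2 ≤ j → j ≤ b - s - 1 → a + s + 2 ≤ j' → j' ≤ b - s - 1 →
      Module.finrank ℂ (V j) = Module.finrank ℂ (V j')) := by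
  have H := isChainPair_total V x y hmm hst heps hsb
  have hdim (i : ℤ) (ha : a ≤ i - s - 2) (hb : i + s + 1 ≤ b) :
      Module.finrank ℂ (V i) = Module.finrank ℂ (V (i - 1)) := by
    rw [← finrank_range_single V i, ← finrank_range_single V (i - 1)]
    exact H.finrank_eq_finrank_sub_one (by lia) (by lia)
  refine ⟨fun i ha hb => ⟨fun v hv hx => ?_, ?_, fun v hv hy => ?_, ?_, hdim i ha hb⟩, ?_⟩
  · refine (map_eq_zero_iff _ (single_injective V i)).1
      (H.eq_zero_of_mem_map_x_pow (i := i) (by lia) (by lia) ?_ ?_)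
    · rw [← map_single_range_Xcomp V x s i (i + s) (by ring)]
      exact Submodule.mem_map_of_mem hv
    · rw [totalX_single, hx, map_zero]
  · apply Submodule.map_injective_of_injective (single_injective V (i - 1))
    rw [map_map_single_x, map_single_range_Xcomp, map_single_range_Xcomp]
    exact H.map_x_map_x_pow (by lia) (by lia)
  · refine (map_eq_zero_iff _ (single_injective V (i - 1))).1
      (H.eq_zero_of_mem_map_y_pow (i := i - 1) (by lia) (by lia) ?_ ?_)
    · rw [← map_single_range_Ycomp V y s (i - 1) (i - 1 - s) (by ring)]
      exact Submodule.mem_map_of_mem hv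
    · rw [totalY_single, hy, map_zero]
  · apply Submodule.map_injective_of_injective (single_injective V i)
    rw [map_map_single_y, map_single_range_Ycomp, map_single_range_Ycomp]
    exact H.map_y_map_y_pow (by lia) (by lia)
  · have key (n : ℕ) (j : ℤ) (hj : a + s + 2 ≤ j) (hn : j + n ≤ b - s - 1) :
        Module.finrank ℂ (V (j + n)) = Module.finrank ℂ (V j) := by
      induction n with
      | zero => rw [Nat.cast_zero, add_zero]
      | succ n ih =>
        push_cast at hn
        rw [hdim _ (by push_cast; lia) (by push_cast; lia),
          show j + ((n + 1 : ℕ) : ℤ) - 1 = j + n by push_cast; ring, ih (by lia)]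
    intro j j' hj hj_le hj' hj'_le
    rcases le_total j j' with h | h
    · obtain ⟨n, rfl⟩ := Int.le.dest h
      exact (key n j hj hj'_le).symm
    · obtain ⟨n, rfl⟩ := Int.le.dest h
      exact key n j' hj' hj_le
end

section
/- Let a chain datum on [a,b] satisfy the moment map relations and the stability condition, and be s-bounded. Then for every i with a ≤ i−s and i+s ≤ b, one has ker Xcomp(s, i) ∩ ker Ycomp(s, i) = 0 in V_i. -/
/-!
A *chain datum* on an integer interval `[a,b]`: finite-dimensional complex vector
spaces `V j` and linear maps `x j : V j → V (j-1)`, `y j : V (j-1) → V j`.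
(The data is given for all `j : ℤ`; all hypotheses and conclusions only refer to
indices in the interval `[a,b]`.)
-/

variable (V : ℤ → Type) [∀ j, AddCommGroup (V j)] [∀ j, Module ℂ (V j)]
  [∀ j, FiniteDimensional ℂ (V j)]

variable (x : ∀ j : ℤ, V j →ₗ[ℂ] V (j - 1)) (y : ∀ j : ℤ, V (j - 1) →ₗ[ℂ] V j)

theorem castV_eq_zero_iff {V : ℤ → Type} [∀ j, AddCommGroup (V j)] [∀ j, Module ℂ (V j)]
    {i j : ℤ} (h : i = j) (v : V i) : castV V h v = 0 ↔ v = 0 := by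
  subst h; rfl

theorem apply_castV {V : ℤ → Type} [∀ j, AddCommGroup (V j)] [∀ j, Module ℂ (V j)]
    (y : ∀ j : ℤ, V (j - 1) →ₗ[ℂ] V j) {i j : ℤ} (h : i = j) (h' : i - 1 = j - 1)
    (v : V (i - 1)) : y j (castV V h' v) = castV V h (y i v) := by
  subst h; rfl

theorem Xcomp_castV_eq_zero_iff {V : ℤ → Type} [∀ j, AddCommGroup (V j)]
    [∀ j, Module ℂ (V j)] (x : ∀ j : ℤ, V j →ₗ[ℂ] V (j - 1)) (m : ℕ) {i j : ℤ} (h : i = j)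
    (v : V i) : Xcomp V x m j (castV V h v) = 0 ↔ Xcomp V x m i v = 0 := by
  subst h; rfl

theorem Ycomp_castV_eq_zero_iff {V : ℤ → Type} [∀ j, AddCommGroup (V j)]
    [∀ j, Module ℂ (V j)] (y : ∀ j : ℤ, V (j - 1) →ₗ[ℂ] V j) (n : ℕ) {i j : ℤ} (h : i = j)
    (v : V i) : Ycomp V y n j (castV V h v) = 0 ↔ Ycomp V y n i v = 0 := by
  subst h; rfl

theorem Xcomp_zero_eq_zero_iff {V : ℤ → Type} [∀ j, AddCommGroup (V j)]
    [∀ j, Module ℂ (V j)] (x : ∀ j : ℤ, V j →ₗ[ℂ] V (j - 1)) (j : ℤ) (v : V j) :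
    Xcomp V x 0 j v = 0 ↔ v = 0 :=
  castV_eq_zero_iff _ _

theorem Ycomp_zero_eq_zero_iff {V : ℤ → Type} [∀ j, AddCommGroup (V j)]
    [∀ j, Module ℂ (V j)] (y : ∀ j : ℤ, V (j - 1) →ₗ[ℂ] V j) (j : ℤ) (v : V j) :
    Ycomp V y 0 j v = 0 ↔ v = 0 :=
  castV_eq_zero_iff _ _

theorem Xcomp_succ_eq_zero_iff {V : ℤ → Type} [∀ j, AddCommGroup (V j)]
    [∀ j, Module ℂ (V j)] (x : ∀ j : ℤ, V j →ₗ[ℂ] V (j - 1)) (m : ℕ) (j : ℤ) (v : V j) :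
    Xcomp V x (m + 1) j v = 0 ↔ Xcomp V x m (j - 1) (x j v) = 0 :=
  castV_eq_zero_iff _ _

theorem Ycomp_succ_eq_zero_iff {V : ℤ → Type} [∀ j, AddCommGroup (V j)]
    [∀ j, Module ℂ (V j)] (y : ∀ j : ℤ, V (j - 1) →ₗ[ℂ] V j) (n : ℕ) (j : ℤ) (v : V j) :
    Ycomp V y (n + 1) j v = 0 ↔
      Ycomp V y n (j + 1) (y (j + 1) (castV V (show j = j + 1 - 1 by ring) v)) = 0 :=
  castV_eq_zero_iff _ _

theorem MomentMap.apply_eq {V : ℤ → Type} [∀ j, AddCommGroup (V j)] [∀ j, Module ℂ (V j)]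
    {x : ∀ j : ℤ, V j →ₗ[ℂ] V (j - 1)} {y : ∀ j : ℤ, V (j - 1) →ₗ[ℂ] V j} {a b : ℤ}
    (hmm : MomentMap V x y a b) {j : ℤ} (ha : a < j) (hb : j < b) (v : V j) :
    y j (x j v) = castV V (show j + 1 - 1 = j by ring)
      (x (j + 1) (y (j + 1) (castV V (show j = j + 1 - 1 by ring) v))) :=
  LinearMap.congr_fun (hmm j ha hb) v

/-- The kernel of `Ycomp` is preserved by `x`. -/
theorem MomentMap.Ycomp_apply_x_eq_zero {V : ℤ → Type} [∀ j, AddCommGroup (V j)]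
    [∀ j, Module ℂ (V j)] {x : ∀ j : ℤ, V j →ₗ[ℂ] V (j - 1)}
    {y : ∀ j : ℤ, V (j - 1) →ₗ[ℂ] V j} {a b : ℤ} (hmm : MomentMap V x y a b) (n : ℕ) {j : ℤ}
    (ha : a < j) (hb : j + n ≤ b) {v : V j} (hv : Ycomp V y n j v = 0) :
    Ycomp V y n (j - 1) (x j v) = 0 := by
  induction n generalizing j with
  | zero => rw [Ycomp_zero_eq_zero_iff] at hv ⊢; simp [hv]
  | succ n ih =>
    push_cast at hb
    rw [Ycomp_succ_eq_zero_iff] at hv ⊢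
    rw [apply_castV y (show j = j - 1 + 1 by ring), Ycomp_castV_eq_zero_iff,
      hmm.apply_eq ha (by omega), Ycomp_castV_eq_zero_iff]
    exact ih (by omega) (by omega) hv

/-- The kernel of `Xcomp` is preserved by `y`. -/
theorem MomentMap.Xcomp_apply_y_eq_zero {V : ℤ → Type} [∀ j, AddCommGroup (V j)]
    [∀ j, Module ℂ (V j)] {x : ∀ j : ℤ, V j →ₗ[ℂ] V (j - 1)}
    {y : ∀ j : ℤ, V (j - 1) →ₗ[ℂ] V j} {a b : ℤ} (hmm : MomentMap V x y a b) (m : ℕ) {j : ℤ}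
    (ha : a ≤ j - m) (hb : j < b) {v : V j} (hv : Xcomp V x m j v = 0) :
    Xcomp V x m (j + 1) (y (j + 1) (castV V (show j = j + 1 - 1 by ring) v)) = 0 := by
  induction m generalizing j with
  | zero => rw [Xcomp_zero_eq_zero_iff] at hv ⊢; simp [hv]
  | succ m ih =>
    push_cast at ha
    rw [Xcomp_succ_eq_zero_iff] at hv ⊢
    rw [← Xcomp_castV_eq_zero_iff x m (show j + 1 - 1 = j by ring),
      ← hmm.apply_eq (by omega) hb]
    have h := ih (by omega) (by omega) hv
    rwa [apply_castV y (show j = j - 1 + 1 by ring), Xcomp_castV_eq_zero_iff] at h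

/-- Asymmetric form of the injectivity statement, which needs no boundedness. -/
theorem Stability.eq_zero_of_Xcomp_of_Ycomp {V : ℤ → Type} [∀ j, AddCommGroup (V j)]
    [∀ j, Module ℂ (V j)] {x : ∀ j : ℤ, V j →ₗ[ℂ] V (j - 1)}
    {y : ∀ j : ℤ, V (j - 1) →ₗ[ℂ] V j} {a b : ℤ} (hst : Stability V x y a b)
    (hmm : MomentMap V x y a b) (m n : ℕ) {j : ℤ} (ha : a ≤ j - m) (hb : j + n ≤ b) {v : V j}
    (hX : Xcomp V x m j v = 0) (hY : Ycomp V y n j v = 0) : v = 0 := by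
  induction m generalizing n j with
  | zero => exact (Xcomp_zero_eq_zero_iff x j v).1 hX
  | succ m ihm =>
    induction n generalizing j with
    | zero => exact (Ycomp_zero_eq_zero_iff y j v).1 hY
    | succ n ihn =>
      have hx : x j v = 0 :=
        ihm (n + 1) (by push_cast at ha; omega) (by omega)
          ((Xcomp_succ_eq_zero_iff x m j v).1 hX)
          (hmm.Ycomp_apply_x_eq_zero (n + 1) (by omega) hb hY)
      have hy : y (j + 1) (castV V (show j = j + 1 - 1 by ring) v) = 0 :=
        ihn (by omega) (by push_cast at hb; omega)
          (hmm.Xcomp_apply_y_eq_zero (m + 1) ha (by omega) hX)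
          ((Ycomp_succ_eq_zero_iff y n j v).1 hY)
      have hmem : v ∈ LinearMap.ker (x j) ⊓
          LinearMap.ker ((y (j + 1)).comp (castV V (show j = j + 1 - 1 by ring))) := ⟨hx, hy⟩
      rwa [hst j (by omega) (by omega), Submodule.mem_bot] at hmem

/-- Under the moment map relations, the stability condition and
`s`-boundedness, `ker Xcomp(s, i) ∩ ker Ycomp(s, i) = 0` in `V i` whenever
`a ≤ i−s` and `i+s ≤ b`. -/
theorem statement3 (a b : ℤ) (hab : a < b) (hmm : MomentMap V x y a b)
    (hst : Stability V x y a b) (s : ℕ) (hs : 1 ≤ s) (hsb : SBounded V x y s a b)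
    (i : ℤ) (h₁ : a ≤ i - s) (h₂ : i + s ≤ b) :
    LinearMap.ker (Xcomp V x s i) ⊓ LinearMap.ker (Ycomp V y s i) = ⊥ := by
  exact (Submodule.eq_bot_iff _).2 fun v hv =>
    hst.eq_zero_of_Xcomp_of_Ycomp hmm s s h₁ h₂ hv.1 hv.2
end

section
/- Let a chain datum on [a,b] satisfy the moment map relations and the ε-condition. Then for every j and every k ≥ 0 with a ≤ j−k−1 and j+k+1 ≤ b, one has V_j = range Xcomp(k, j+k) + range Ycomp(k, j−k). -/
/-!
A *chain datum* on an integer interval `[a,b]`: finite-dimensional complex vector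
spaces `V j` and linear maps `x j : V j → V (j-1)`, `y j : V (j-1) → V j`.
(The data is given for all `j : ℤ`; all hypotheses and conclusions only refer to
indices in the interval `[a,b]`.)
-/

variable (V : ℤ → Type) [∀ j, AddCommGroup (V j)] [∀ j, Module ℂ (V j)]
  [∀ j, FiniteDimensional ℂ (V j)]

variable (x : ∀ j : ℤ, V j →ₗ[ℂ] V (j - 1)) (y : ∀ j : ℤ, V (j - 1) →ₗ[ℂ] V j)

set_option linter.unusedSectionVars false

@[simp]
theorem castV_rfl {i : ℤ} (h : i = i) (v : V i) : castV V h v = v := rfl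

@[simp]
theorem castV_castV {i j k : ℤ} (h : i = j) (h' : j = k) (v : V i) :
    castV V h' (castV V h v) = castV V (h.trans h') v := by
  subst h h'; rfl

theorem range_castV {i j : ℤ} (h : i = j) : LinearMap.range (castV V h) = ⊤ := by
  subst h; exact LinearMap.range_id

/-- The map `x_{j+1}`, regarded as a map `V (j + 1) → V j`. -/
def lowerMap (j : ℤ) : V (j + 1) →ₗ[ℂ] V j :=
  (castV V (show j + 1 - 1 = j by ring)).comp (x (j + 1))

/-- The map `y_{j+1}`, regarded as a map `V j → V (j + 1)`. -/
def raiseMap (j : ℤ) : V j →ₗ[ℂ] V (j + 1) :=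
  (y (j + 1)).comp (castV V (show j = j + 1 - 1 by ring))

/-- The image in `V j` of the composition of `n` maps `x` ending at `V j`. -/
def rangeX : ℕ → (j : ℤ) → Submodule ℂ (V j)
  | 0, _ => ⊤
  | n + 1, j => (rangeX n (j + 1)).map (lowerMap V x j)

/-- The image in `V j` of the composition of `n` maps `y` ending at `V j`. -/
def rangeY : ℕ → (j : ℤ) → Submodule ℂ (V j)
  | 0, _ => ⊤
  | n + 1, j => (rangeY n (j - 1)).map (y j)

theorem castV_comp_x {i j : ℤ} (h : i = j + 1) (h' : i - 1 = j) (v : V i) :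
    castV V h' (x i v) = lowerMap V x j (castV V h v) := by
  subst h; rfl

theorem castV_x {i j : ℤ} (h : i = j) (h' : i - 1 = j - 1) (v : V i) :
    castV V h' (x i v) = x j (castV V h v) := by
  subst h; rfl

theorem castV_comp_y {i j : ℤ} (h : i = j) (h' : i - 1 = j - 1) (v : V (i - 1)) :
    castV V h (y i v) = y j (castV V h' v) := by
  subst h; rfl

theorem castV_Xcomp_succ (k : ℕ) (i j : ℤ) (h : i - ((k + 1 : ℕ) : ℤ) = j)
    (h' : i - (k : ℤ) = j + 1) (v : V i) :
    castV V h (Xcomp V x (k + 1) i v) = lowerMap V x j (castV V h' (Xcomp V x k i v)) := by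
  induction k generalizing i with
  | zero =>
    simp only [Xcomp, LinearMap.comp_apply, castV_castV]
    exact castV_comp_x V x _ _ v
  | succ k ih =>
    have := ih (i - 1) (by push_cast at h ⊢; linarith) (by push_cast at h' ⊢; linarith) (x i v)
    rw [Xcomp, LinearMap.comp_apply, LinearMap.comp_apply, castV_castV, this,
      Xcomp, LinearMap.comp_apply, LinearMap.comp_apply, castV_castV]

theorem castV_Ycomp_succ (k : ℕ) (i j : ℤ) (h : i + ((k + 1 : ℕ) : ℤ) = j)
    (h' : i + (k : ℤ) = j - 1) (v : V i) :
    castV V h (Ycomp V y (k + 1) i v) = y j (castV V h' (Ycomp V y k i v)) := by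
  induction k generalizing i with
  | zero =>
    simp only [Ycomp, LinearMap.comp_apply, castV_castV]
    rw [castV_comp_y V y (by simpa using h) (by simpa using h'), castV_castV]
  | succ k ih =>
    have := ih (i + 1) (by push_cast at h ⊢; linarith) (by push_cast at h' ⊢; linarith)
      (y (i + 1) (castV V (by ring) v))
    rw [Ycomp, LinearMap.comp_apply, LinearMap.comp_apply, LinearMap.comp_apply, castV_castV,
      this, Ycomp, LinearMap.comp_apply, LinearMap.comp_apply, LinearMap.comp_apply, castV_castV]

theorem range_castV_comp_Xcomp (k : ℕ) (i j : ℤ) (h : i - (k : ℤ) = j) :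
    LinearMap.range ((castV V h).comp (Xcomp V x k i)) = rangeX V x k j := by
  induction k generalizing j with
  | zero =>
    rw [Xcomp, rangeX, ← range_castV V (show i = j by simpa using h)]
    congr 1
    ext v
    simp
  | succ k ih =>
    rw [rangeX, ← ih (j + 1) (by push_cast at h; linarith), ← LinearMap.range_comp]
    congr 1
    ext v
    exact castV_Xcomp_succ V x k i j h _ v

theorem range_castV_comp_Ycomp (k : ℕ) (i j : ℤ) (h : i + (k : ℤ) = j) :
    LinearMap.range ((castV V h).comp (Ycomp V y k i)) = rangeY V y k j := by
  induction k generalizing j with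
  | zero =>
    rw [Ycomp, rangeY, ← range_castV V (show i = j by simpa using h)]
    congr 1
    ext v
    simp
  | succ k ih =>
    rw [rangeY, ← ih (j - 1) (by push_cast at h; linarith), ← LinearMap.range_comp]
    congr 1
    ext v
    exact castV_Ycomp_succ V y k i j h _ v

theorem map_castV_rangeY (n : ℕ) {i j : ℤ} (h : i = j) :
    (rangeY V y n i).map (castV V h) = rangeY V y n j := by
  subst h; exact Submodule.map_id _

theorem rangeY_succ_add_one (n : ℕ) (j : ℤ) :
    rangeY V y (n + 1) (j + 1) = (rangeY V y n j).map (raiseMap V y j) := by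
  rw [rangeY, raiseMap, Submodule.map_comp, map_castV_rangeY]

section

variable {V x y} {a b : ℤ}

theorem MomentMap.apply (hmm : MomentMap V x y a b) {j : ℤ} (ha : a < j) (hb : j < b) (v : V j) :
    y j (x j v) = lowerMap V x j (raiseMap V y j v) :=
  LinearMap.congr_fun (hmm j ha hb) v

/-- The endomorphism `x_{j+1} ∘ y_{j+1}` preserves the image of `Ycomp n`. -/
theorem MomentMap.map_rangeY_le (hmm : MomentMap V x y a b) (n : ℕ) {j : ℤ}
    (ha : a ≤ j - n) (hb : j < b) :
    (rangeY V y n j).map ((lowerMap V x j).comp (raiseMap V y j)) ≤ rangeY V y n j := by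
  induction n generalizing j with
  | zero => exact le_top
  | succ n ih =>
    push_cast at ha
    rintro _ ⟨_, ⟨w, hw, rfl⟩, rfl⟩
    rw [LinearMap.comp_apply, ← hmm.apply (by linarith [Int.natCast_nonneg n]) hb]
    refine Submodule.mem_map_of_mem (ih (j := j - 1) (by linarith) (by linarith) ⟨w, hw, ?_⟩)
    simp only [lowerMap, raiseMap, LinearMap.comp_apply]
    rw [castV_x V x (show j - 1 + 1 = j by ring), castV_comp_y V y _ (by ring), castV_castV,
      castV_rfl]

theorem EpsCond.range_lowerMap_sup_rangeY (heps : EpsCond V x y a b) (hmm : MomentMap V x y a b)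
    (n : ℕ) {j : ℤ} (ha : a ≤ j - n) (hb : j < b) :
    LinearMap.range (lowerMap V x j) ⊔ rangeY V y n j = ⊤ := by
  induction n generalizing j with
  | zero => exact sup_top_eq _
  | succ n ih =>
    push_cast at ha
    have haj : a < j := by linarith [Int.natCast_nonneg n]
    have hle : LinearMap.range (y j) ≤
        LinearMap.range (lowerMap V x j) ⊔ rangeY V y (n + 1) j := by
      rw [LinearMap.range_eq_map, ← ih (j := j - 1) (by linarith) (by linarith), Submodule.map_sup]
      refine sup_le_sup ?_ le_rfl
      rintro _ ⟨_, ⟨v, rfl⟩, rfl⟩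
      have hv : lowerMap V x (j - 1) v = x j (castV V (by ring) v) :=
        castV_x V x (by ring) _ v
      rw [hv, hmm.apply haj hb]
      exact LinearMap.mem_range_self _ _
    rw [eq_top_iff, ← heps j haj hb]
    exact sup_le le_sup_left hle

theorem EpsCond.rangeX_sup_rangeY (heps : EpsCond V x y a b) (hmm : MomentMap V x y a b)
    (m n : ℕ) {j : ℤ} (ha : a ≤ j - n) (hb : j + m ≤ b) :
    rangeX V x m j ⊔ rangeY V y n j = ⊤ := by
  induction m generalizing n j with
  | zero => exact top_sup_eq _
  | succ m ih =>
    push_cast at hb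
    have hjb : j < b := by linarith [Int.natCast_nonneg m]
    rw [eq_top_iff, ← heps.range_lowerMap_sup_rangeY hmm n ha hjb, LinearMap.range_eq_map,
      ← ih (n + 1) (j := j + 1) (by push_cast; linarith) (by linarith), Submodule.map_sup,
      rangeY_succ_add_one, ← Submodule.map_comp]
    exact sup_le (sup_le_sup le_rfl (hmm.map_rangeY_le n ha hjb)) le_sup_right

end

/-- Under the moment map relations and the ε-condition,
`V j = range Xcomp(k, j+k) + range Ycomp(k, j−k)` whenever `a ≤ j−k−1` and
`j+k+1 ≤ b`. -/
theorem statement4 (a b : ℤ) (hab : a < b) (hmm : MomentMap V x y a b)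
    (heps : EpsCond V x y a b) (j : ℤ) (k : ℕ)
    (h₁ : a ≤ j - k - 1) (h₂ : j + k + 1 ≤ b) :
    LinearMap.range ((castV V (show j + (k : ℤ) - (k : ℤ) = j by ring)).comp
        (Xcomp V x k (j + k))) ⊔
      LinearMap.range ((castV V (show j - (k : ℤ) + (k : ℤ) = j by ring)).comp
        (Ycomp V y k (j - k))) = ⊤ := by
  rw [range_castV_comp_Xcomp, range_castV_comp_Ycomp]
  exact heps.rangeX_sup_rangeY hmm k k (by linarith) (by linarith)
end

section
/- Let (V, W, x, t) be a stable framed representation of a finite undirected loopless graph X over ℂ. If (g_i) is a family of linear automorphisms g_i : V_i → V_i indexed by the vertices of X such that g_j ∘ x_e = x_e ∘ g_i for every directed edge e : i → j and t_i ∘ g_i = t_i for every vertex i, then g_i is the identity of V_i for every vertex i. (In particular, the group ∏_i GL(V_i) acts freely on the set of stable framed representations with fixed underlying spaces.) -/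
noncomputable section

/-!
Finite undirected loopless (multi)graphs with a fixed orientation: each edge `e`
has a source `src e` and a target `tgt e`, and carries maps in both directions.
-/

structure Multigraph where
  V : Type
  E : Type
  [fintypeV : Fintype V]
  [fintypeE : Fintype E]
  [decEqV : DecidableEq V]
  src : E → V
  tgt : E → V
  loopless : ∀ e, src e ≠ tgt e

attribute [instance] Multigraph.fintypeV Multigraph.fintypeE Multigraph.decEqV

/-- The edge `e` joins the vertices `u` and `v` (in either direction). -/
def Multigraph.Joins (G : Multigraph) (e : G.E) (u v : G.V) : Prop :=
  (G.src e = u ∧ G.tgt e = v) ∨ (G.src e = v ∧ G.tgt e = u)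

/-- Directed edges: each edge in both directions. -/
def Multigraph.dsrc (G : Multigraph) : G.E ⊕ G.E → G.V := Sum.elim G.src G.tgt

def Multigraph.dtgt (G : Multigraph) : G.E ⊕ G.E → G.V := Sum.elim G.tgt G.src

/-- Transport of a fibre along an equality of vertices. -/
def castL {G : Multigraph} {v : G.V → ℕ} {i j : G.V} (h : i = j) :
    (Fin (v i) → ℂ) →ₗ[ℂ] (Fin (v j) → ℂ) := by subst h; exact LinearMap.id

/-- A framed representation of `G` with dimension vectors `v, w`, on the fixed
vector spaces `V_i = ℂ^{v i}`, `W_i = ℂ^{w i}`: a map `x e` across each edge in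
each direction, and a map `t i : V_i → W_i` at each vertex. -/
structure FramedRep (G : Multigraph) (v w : G.V → ℕ) where
  x : ∀ e : G.E, (Fin (v (G.src e)) → ℂ) →ₗ[ℂ] (Fin (v (G.tgt e)) → ℂ)
  xbar : ∀ e : G.E, (Fin (v (G.tgt e)) → ℂ) →ₗ[ℂ] (Fin (v (G.src e)) → ℂ)
  t : ∀ i : G.V, (Fin (v i) → ℂ) →ₗ[ℂ] (Fin (w i) → ℂ)

namespace FramedRep

variable {G : Multigraph} {v w : G.V → ℕ}

/-- The map assigned to a directed edge. -/
def dmap (ρ : FramedRep G v w) :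
    ∀ d : G.E ⊕ G.E, (Fin (v (G.dsrc d)) → ℂ) →ₗ[ℂ] (Fin (v (G.dtgt d)) → ℂ)
  | Sum.inl e => ρ.x e
  | Sum.inr e => ρ.xbar e

/-- Stability: the only subrepresentation `U` contained in `V` (i.e. invariant
under all the directed edge maps and contained in `ker t`) is zero. -/
def Stable (ρ : FramedRep G v w) : Prop :=
  ∀ U : ∀ i : G.V, Submodule ℂ (Fin (v i) → ℂ),
    (∀ d : G.E ⊕ G.E, (U (G.dsrc d)).map (ρ.dmap d) ≤ U (G.dtgt d)) →
    (∀ i, U i ≤ LinearMap.ker (ρ.t i)) →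
    ∀ i, U i = ⊥

/-- The endomorphism of the total space `⊕_i V_i` induced by a directed edge. -/
def edgeEnd (ρ : FramedRep G v w) (d : G.E ⊕ G.E) :
    Module.End ℂ (∀ i : G.V, Fin (v i) → ℂ) :=
  LinearMap.pi fun j =>
    if h : G.dtgt d = j then
      (castL h).comp ((ρ.dmap d).comp (LinearMap.proj (G.dsrc d)))
    else 0

/-- Nilpotency: some length `N` such that every composite of `N` of the
directed edge maps (along any path) vanishes. -/
def IsNilpotentRep (ρ : FramedRep G v w) : Prop :=
  ∃ N : ℕ, ∀ L : List (G.E ⊕ G.E), L.length = N → (L.map ρ.edgeEnd).prod = 0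

/-- The moment map condition at every vertex:
`Σ_{e : tgt e = i} x_e ∘ x_ē = Σ_{e : src e = i} x_ē ∘ x_e` on `V_i`. -/
def MomentMap (ρ : FramedRep G v w) : Prop :=
  ∀ i : G.V,
    (∑ e : G.E, if h : G.tgt e = i then
        (castL h).comp ((ρ.x e).comp ((ρ.xbar e).comp (castL h.symm))) else 0)
      =
    ∑ e : G.E, if h : G.src e = i then
        (castL h).comp ((ρ.xbar e).comp ((ρ.x e).comp (castL h.symm))) else 0

/-- The sum of the ranges of all edge maps into the vertex `j`. -/
def rangeSup (ρ : FramedRep G v w) (j : G.V) : Submodule ℂ (Fin (v j) → ℂ) :=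
  ⨆ d : G.E ⊕ G.E, ⨆ h : G.dtgt d = j, LinearMap.range ((castL h).comp (ρ.dmap d))

/-- `ε_j`: the codimension in `V_j` of the sum of the ranges of all incoming
edge maps. -/
def epsVal (ρ : FramedRep G v w) (j : G.V) : ℕ :=
  v j - Module.finrank ℂ (ρ.rangeSup j)

/-- Isomorphism of framed representations (on the same fixed spaces). -/
def Iso (ρ ρ' : FramedRep G v w) : Prop :=
  ∃ g : ∀ i : G.V, (Fin (v i) → ℂ) ≃ₗ[ℂ] (Fin (v i) → ℂ),
    (∀ e : G.E, (g (G.tgt e)).toLinearMap.comp (ρ.x e)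
        = (ρ'.x e).comp (g (G.src e)).toLinearMap) ∧
    (∀ e : G.E, (g (G.src e)).toLinearMap.comp (ρ.xbar e)
        = (ρ'.xbar e).comp (g (G.tgt e)).toLinearMap) ∧
    (∀ i : G.V, (ρ'.t i).comp (g i).toLinearMap = ρ.t i)

end FramedRep

/-- If `(V, W, x, t)` is a stable framed representation of a
finite undirected loopless graph `X` and `(g i)` is a family of linear
automorphisms commuting with all the directed edge maps and satisfying
`t i ∘ g i = t i`, then every `g i` is the identity.  (The group `∏ GL(V_i)`
acts freely on stable framed representations.) -/
theorem statement9 (G : Multigraph) (v w : G.V → ℕ) (ρ : FramedRep G v w)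
    (hstab : ρ.Stable)
    (g : ∀ i : G.V, (Fin (v i) → ℂ) ≃ₗ[ℂ] (Fin (v i) → ℂ))
    (hx : ∀ e : G.E, (g (G.tgt e)).toLinearMap.comp (ρ.x e)
        = (ρ.x e).comp (g (G.src e)).toLinearMap)
    (hxbar : ∀ e : G.E, (g (G.src e)).toLinearMap.comp (ρ.xbar e)
        = (ρ.xbar e).comp (g (G.tgt e)).toLinearMap)
    (ht : ∀ i : G.V, (ρ.t i).comp (g i).toLinearMap = ρ.t i) :
    ∀ i : G.V, g i = LinearEquiv.refl ℂ (Fin (v i) → ℂ) := by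
  have hrange := hstab (fun i => LinearMap.range ((g i).toLinearMap - LinearMap.id)) ?_ ?_
  · intro i
    have h := LinearMap.range_eq_bot.mp (hrange i)
    ext1 u
    exact sub_eq_zero.mp (LinearMap.congr_fun h u)
  · rintro (e | e) _ ⟨_, ⟨u, rfl⟩, rfl⟩
    · change Fin (v (G.src e)) → ℂ at u
      refine ⟨ρ.x e u, ?_⟩
      have h := LinearMap.congr_fun (hx e) u
      change g (G.tgt e) (ρ.x e u) - ρ.x e u = ρ.x e (g (G.src e) u - u)
      rw [map_sub]
      exact congrArg (· - ρ.x e u) h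
    · change Fin (v (G.tgt e)) → ℂ at u
      refine ⟨ρ.xbar e u, ?_⟩
      have h := LinearMap.congr_fun (hxbar e) u
      change g (G.src e) (ρ.xbar e u) - ρ.xbar e u = ρ.xbar e (g (G.tgt e) u - u)
      rw [map_sub]
      exact congrArg (· - ρ.xbar e u) h
  · rintro i _ ⟨u, rfl⟩
    have h := LinearMap.congr_fun (ht i) u
    change ρ.t i (g i u - u) = 0
    rw [map_sub]
    exact sub_eq_zero.mpr h
end
end
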